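/- Let k₀ > 0 and let ρ : ℝ² → ℝ be smooth with ρ > 0; set w := √ρ and define the quantum stress tensor S(ρ) := (1/(2k₀²))(∇w ⊗ ∇w − w ∇²w), where ∇²w is the Hessian of w. Then div S(ρ) = −(1/(2k₀²)) ρ ∇( Δw / w ) = −(1/(2k₀²)) ρ ∇Q(ρ), where Q(ρ) := Δ√ρ/√ρ and the divergence of the matrix field S is taken row-wise. -/

import Mathlib

noncomputable section

/-- Partial derivative in the first (x) variable of a function of (x, y). -/
def dx2 (f : ℝ → ℝ → ℝ) (x y : ℝ) : ℝ := deriv (fun t => f t y) x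

/-- Partial derivative in the second (y) variable of a function of (x, y). -/
def dy2 (f : ℝ → ℝ → ℝ) (x y : ℝ) : ℝ := deriv (fun t => f x t) y

/-- `w := √ρ`. -/
def wF (ρ : ℝ → ℝ → ℝ) (x y : ℝ) : ℝ := Real.sqrt (ρ x y)

/-- The quantum pressure `Q(ρ) = Δ√ρ/√ρ = Δw/w`. -/
def Q2 (ρ : ℝ → ℝ → ℝ) (x y : ℝ) : ℝ :=
  (dx2 (dx2 (wF ρ)) x y + dy2 (dy2 (wF ρ)) x y) / wF ρ x y

/-- Quantum stress tensor entry `S₁₁ = (1/(2k₀²))(w_x w_x − w w_{xx})`. -/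
def T11 (k₀ : ℝ) (ρ : ℝ → ℝ → ℝ) (x y : ℝ) : ℝ :=
  (1 / (2 * k₀ ^ 2)) * (dx2 (wF ρ) x y * dx2 (wF ρ) x y - wF ρ x y * dx2 (dx2 (wF ρ)) x y)

/-- Quantum stress tensor entry `S₁₂ = (1/(2k₀²))(w_x w_y − w w_{xy})`. -/
def T12 (k₀ : ℝ) (ρ : ℝ → ℝ → ℝ) (x y : ℝ) : ℝ :=
  (1 / (2 * k₀ ^ 2)) * (dx2 (wF ρ) x y * dy2 (wF ρ) x y - wF ρ x y * dx2 (dy2 (wF ρ)) x y)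

/-- Quantum stress tensor entry `S₂₁ = (1/(2k₀²))(w_y w_x − w w_{yx})`. -/
def T21 (k₀ : ℝ) (ρ : ℝ → ℝ → ℝ) (x y : ℝ) : ℝ :=
  (1 / (2 * k₀ ^ 2)) * (dy2 (wF ρ) x y * dx2 (wF ρ) x y - wF ρ x y * dy2 (dx2 (wF ρ)) x y)

/-- Quantum stress tensor entry `S₂₂ = (1/(2k₀²))(w_y w_y − w w_{yy})`. -/
def T22 (k₀ : ℝ) (ρ : ℝ → ℝ → ℝ) (x y : ℝ) : ℝ :=
  (1 / (2 * k₀ ^ 2)) * (dy2 (wF ρ) x y * dy2 (wF ρ) x y - wF ρ x y * dy2 (dy2 (wF ρ)) x y)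

def Sm (f : ℝ → ℝ → ℝ) : Prop := ContDiff ℝ (⊤ : ℕ∞) (fun p : ℝ × ℝ => f p.1 p.2)

lemma Sm.hx0 {f : ℝ → ℝ → ℝ} (h : Sm f) (x y : ℝ) :
    HasDerivAt (fun t => f t y) (fderiv ℝ (fun p : ℝ × ℝ => f p.1 p.2) (x, y) (1, 0)) x := by
  have h1 : HasFDerivAt (fun p : ℝ × ℝ => f p.1 p.2) _ (x, y) :=
    ((ContDiff.differentiable h (by simp)) (x, y)).hasFDerivAt
  have h2 : HasDerivAt (fun t : ℝ => (t, y)) ((1 : ℝ), (0 : ℝ)) x :=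
    (hasDerivAt_id x).prodMk (hasDerivAt_const x y)
  exact h1.comp_hasDerivAt x h2

lemma Sm.hy0 {f : ℝ → ℝ → ℝ} (h : Sm f) (x y : ℝ) :
    HasDerivAt (fun t => f x t) (fderiv ℝ (fun p : ℝ × ℝ => f p.1 p.2) (x, y) (0, 1)) y := by
  have h1 : HasFDerivAt (fun p : ℝ × ℝ => f p.1 p.2) _ (x, y) :=
    ((ContDiff.differentiable h (by simp)) (x, y)).hasFDerivAt
  have h2 : HasDerivAt (fun t : ℝ => (x, t)) ((0 : ℝ), (1 : ℝ)) y :=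
    (hasDerivAt_const y x).prodMk (hasDerivAt_id y)
  exact h1.comp_hasDerivAt y h2

lemma Sm.hx {f : ℝ → ℝ → ℝ} (h : Sm f) (x y : ℝ) :
    HasDerivAt (fun t => f t y) (dx2 f x y) x := (h.hx0 x y).differentiableAt.hasDerivAt

lemma Sm.hy {f : ℝ → ℝ → ℝ} (h : Sm f) (x y : ℝ) :
    HasDerivAt (fun t => f x t) (dy2 f x y) y := (h.hy0 x y).differentiableAt.hasDerivAt

lemma Sm.dx_eq {f : ℝ → ℝ → ℝ} (h : Sm f) : (fun p : ℝ × ℝ => dx2 f p.1 p.2) =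
    fun p => fderiv ℝ (fun p : ℝ × ℝ => f p.1 p.2) p (1, 0) := by
  funext p; exact (h.hx0 p.1 p.2).deriv

lemma Sm.dy_eq {f : ℝ → ℝ → ℝ} (h : Sm f) : (fun p : ℝ × ℝ => dy2 f p.1 p.2) =
    fun p => fderiv ℝ (fun p : ℝ × ℝ => f p.1 p.2) p (0, 1) := by
  funext p; exact (h.hy0 p.1 p.2).deriv

lemma Sm.fd {f : ℝ → ℝ → ℝ} (h : Sm f) :
    ContDiff ℝ (⊤ : ℕ∞) (fderiv ℝ (fun p : ℝ × ℝ => f p.1 p.2)) :=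
  ContDiff.fderiv_right (m := (⊤ : ℕ∞)) h (by simp)

lemma Sm.dx {f : ℝ → ℝ → ℝ} (h : Sm f) : Sm (dx2 f) := by
  unfold Sm; rw [h.dx_eq]; exact h.fd.clm_apply contDiff_const

lemma Sm.dy {f : ℝ → ℝ → ℝ} (h : Sm f) : Sm (dy2 f) := by
  unfold Sm; rw [h.dy_eq]; exact h.fd.clm_apply contDiff_const

lemma Sm.comm {f : ℝ → ℝ → ℝ} (h : Sm f) : dx2 (dy2 f) = dy2 (dx2 f) := by
  funext x y
  have e1 : dx2 (dy2 f) x y = _ := (h.dy.hx0 x y).deriv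
  have e2 : dy2 (dx2 f) x y = _ := (h.dx.hy0 x y).deriv
  have hd : DifferentiableAt ℝ (fderiv ℝ (fun p : ℝ × ℝ => f p.1 p.2)) (x, y) :=
    (h.fd.differentiable (by simp)) _
  have hs : IsSymmSndFDerivAt ℝ (fun p : ℝ × ℝ => f p.1 p.2) (x, y) :=
    (ContDiff.contDiffAt h).isSymmSndFDerivAt (by simp; exact WithTop.coe_le_coe.2 (le_top : (2 : ℕ∞) ≤ ⊤))
  rw [e1, e2, h.dx_eq, h.dy_eq, fderiv_clm_apply hd (by fun_prop),
    fderiv_clm_apply hd (by fun_prop)]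
  simpa using hs (1, 0) (0, 1)

/-- **Divergence of the quantum stress tensor.** For smooth `ρ > 0` on `ℝ²` and
`w = √ρ`, the row-wise divergence of `S(ρ) = (1/(2k₀²))(∇w ⊗ ∇w − w ∇²w)` satisfies
`div S(ρ) = −(1/(2k₀²)) ρ ∇(Δw/w) = −(1/(2k₀²)) ρ ∇Q(ρ)` (stated componentwise). -/
theorem quantum_stress_divergence
    (k₀ : ℝ) (hk₀ : 0 < k₀)
    (ρ : ℝ → ℝ → ℝ)
    (hρ_smooth : ContDiff ℝ (⊤ : ℕ∞) (fun p : ℝ × ℝ => ρ p.1 p.2))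
    (hρ_pos : ∀ x y : ℝ, 0 < ρ x y) :
    ∀ x y : ℝ,
      (dx2 (T11 k₀ ρ) x y + dy2 (T12 k₀ ρ) x y
        = -(1 / (2 * k₀ ^ 2)) * ρ x y * dx2 (Q2 ρ) x y)
      ∧
      (dx2 (T21 k₀ ρ) x y + dy2 (T22 k₀ ρ) x y
        = -(1 / (2 * k₀ ^ 2)) * ρ x y * dy2 (Q2 ρ) x y) := by
  intro x y
  have hw : Sm (wF ρ) := by
    unfold Sm wF
    exact hρ_smooth.sqrt (fun p => (hρ_pos p.1 p.2).ne')
  have hpos : wF ρ x y ≠ 0 := (Real.sqrt_pos.2 (hρ_pos x y)).ne'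
  have hsq : ρ x y = wF ρ x y ^ 2 := (Real.sq_sqrt (hρ_pos x y).le).symm
  have c0 := hw.comm
  have c1 := hw.dx.comm
  have c2 := hw.dy.comm
  have q1 : dx2 (Q2 ρ) x y = _ :=
    (((hw.dx.dx.hx x y).add (hw.dy.dy.hx x y)).div (hw.hx x y) hpos).deriv
  have q2 : dy2 (Q2 ρ) x y = _ :=
    (((hw.dx.dx.hy x y).add (hw.dy.dy.hy x y)).div (hw.hy x y) hpos).deriv
  have t11 : dx2 (T11 k₀ ρ) x y = _ :=
    ((((hw.dx.hx x y).mul (hw.dx.hx x y)).sub ((hw.hx x y).mul (hw.dx.dx.hx x y))).const_mul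
      (1 / (2 * k₀ ^ 2))).deriv
  have t12 : dy2 (T12 k₀ ρ) x y = _ :=
    ((((hw.dx.hy x y).mul (hw.dy.hy x y)).sub ((hw.hy x y).mul (hw.dy.dx.hy x y))).const_mul
      (1 / (2 * k₀ ^ 2))).deriv
  have t21 : dx2 (T21 k₀ ρ) x y = _ :=
    ((((hw.dy.hx x y).mul (hw.dx.hx x y)).sub ((hw.hx x y).mul (hw.dx.dy.hx x y))).const_mul
      (1 / (2 * k₀ ^ 2))).deriv
  have t22 : dy2 (T22 k₀ ρ) x y = _ :=
    ((((hw.dy.hy x y).mul (hw.dy.hy x y)).sub ((hw.hy x y).mul (hw.dy.dy.hy x y))).const_mul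
      (1 / (2 * k₀ ^ 2))).deriv
  rw [q1, q2, t11, t12, t21, t22, hsq]
  simp only [Pi.add_apply, c0, c1, c2]
  have hk : k₀ ≠ 0 := hk₀.ne'
  constructor
  · field_simp
    ring
  · field_simp
    ring

end
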